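/- Averaging theorem (Theorem 1): Let D be a bounded open subset of ℝⁿ, let F : ℝⁿ × ℝ → ℝⁿ be continuous, 2π-periodic in its second argument, bounded by a constant M on D × ℝ, and Lipschitz in its first argument on D with Lipschitz constant ℓ uniformly in the second argument. Define the averaged field F̄(y) = (1/(2π)) ∫₀^{2π} F(y, τ) dτ. Fix T > 0, ε_max > 0 and an initial point z₀ ∈ D. Then there exists a constant c > 0 such that for every ε with 0 < ε ≤ ε_max, if z : ℝ → ℝⁿ and y : ℝ → ℝⁿ are differentiable functions satisfying z'(τ) = ε F(z(τ), τ) and y'(τ) = ε F̄(y(τ)) for all τ ∈ [0, T/ε], with z(0) = y(0) = z₀, and both z(τ) and y(τ) remain in D for all τ ∈ [0, T/ε], then ‖z(τ) − y(τ)‖ ≤ c ε for all τ ∈ [0, T/ε]. -/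

import Mathlib

section Averaging

open Set MeasureTheory

variable {E : Type*} [NormedAddCommGroup E] [NormedSpace ℝ E]

/-- Along a slowly varying curve `Y` in `D`, the integral over one period of a field with zero
mean is small. -/
lemma norm_integral_period_le_of_zero_mean {D : Set E} {g : E → ℝ → E} {P K Λ : ℝ}
    (hP : 0 < P) (hK : 0 ≤ K) (hΛ : 0 ≤ Λ) (hg : Continuous fun p : E × ℝ => g p.1 p.2)
    (hper : ∀ x, Function.Periodic (g x) P) (hmean : ∀ x, ∫ s in (0:ℝ)..P, g x s = 0)
    (hlip : ∀ s, ∀ x₁ ∈ D, ∀ x₂ ∈ D, ‖g x₁ s - g x₂ s‖ ≤ Λ * ‖x₁ - x₂‖)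
    {Y : ℝ → E} (hY : Continuous Y) (hYD : ∀ s, Y s ∈ D)
    (hYlip : ∀ s t, ‖Y s - Y t‖ ≤ K * |s - t|) (t : ℝ) :
    ‖∫ s in t..(t + P), g (Y s) s‖ ≤ Λ * K * P * P := by
  have hmean' : ∫ s in t..(t + P), g (Y t) s = 0 := by
    rw [(hper (Y t)).intervalIntegral_add_eq t 0, zero_add, hmean]
  have hc₁ : Continuous fun s => g (Y s) s := hg.comp (hY.prodMk continuous_id)
  have hc₂ : Continuous fun s => g (Y t) s := hg.comp (continuous_const.prodMk continuous_id)
  have hsub : ∫ s in t..(t + P), g (Y s) s = ∫ s in t..(t + P), (g (Y s) s - g (Y t) s) := by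
    rw [intervalIntegral.integral_sub (hc₁.intervalIntegrable _ _) (hc₂.intervalIntegrable _ _),
      hmean', sub_zero]
  rw [hsub]
  have hbound : ∀ s ∈ uIoc t (t + P), ‖g (Y s) s - g (Y t) s‖ ≤ Λ * K * P := by
    intro s hs
    rw [uIoc_of_le (by linarith)] at hs
    have hst : |s - t| ≤ P := by
      rw [abs_of_pos (by linarith [hs.1])]
      linarith [hs.2]
    calc ‖g (Y s) s - g (Y t) s‖ ≤ Λ * ‖Y s - Y t‖ := hlip s _ (hYD s) _ (hYD t)
      _ ≤ Λ * (K * P) := by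
        gcongr
        exact (hYlip s t).trans (by gcongr)
      _ = Λ * K * P := by ring
  have := intervalIntegral.norm_integral_le_of_norm_le_const hbound
  rwa [add_sub_cancel_left, abs_of_pos hP] at this

lemma norm_integral_le_of_zero_mean {D : Set E} {g : E → ℝ → E} {P K Λ B : ℝ}
    (hP : 0 < P) (hK : 0 ≤ K) (hΛ : 0 ≤ Λ) (hg : Continuous fun p : E × ℝ => g p.1 p.2)
    (hper : ∀ x, Function.Periodic (g x) P) (hmean : ∀ x, ∫ s in (0:ℝ)..P, g x s = 0)
    (hbdd : ∀ x ∈ D, ∀ s, ‖g x s‖ ≤ B)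
    (hlip : ∀ s, ∀ x₁ ∈ D, ∀ x₂ ∈ D, ‖g x₁ s - g x₂ s‖ ≤ Λ * ‖x₁ - x₂‖)
    {Y : ℝ → E} (hY : Continuous Y) (hYD : ∀ s, Y s ∈ D)
    (hYlip : ∀ s t, ‖Y s - Y t‖ ≤ K * |s - t|) {τ : ℝ} (hτ : 0 ≤ τ) :
    ‖∫ s in (0:ℝ)..τ, g (Y s) s‖ ≤ Λ * K * P * τ + B * P := by
  have hc : Continuous fun s => g (Y s) s := hg.comp (hY.prodMk continuous_id)
  have hB : 0 ≤ B := (norm_nonneg _).trans (hbdd _ (hYD 0) 0)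
  have hperiods : ∀ k : ℕ, ‖∫ s in (0:ℝ)..(k * P), g (Y s) s‖ ≤ Λ * K * P * (k * P) := by
    intro k
    induction k with
    | zero => simp
    | succ k ih =>
      have hk : ((k + 1 : ℕ) : ℝ) * P = k * P + P := by push_cast; ring
      rw [hk, ← intervalIntegral.integral_add_adjacent_intervals
        (hc.intervalIntegrable 0 (k * P)) (hc.intervalIntegrable _ _)]
      have h := norm_integral_period_le_of_zero_mean hP hK hΛ hg hper hmean hlip hY hYD hYlip
        (k * P)
      refine (norm_add_le _ _).trans ?_
      linarith
  obtain ⟨k, hkτ, hτk⟩ : ∃ k : ℕ, k * P ≤ τ ∧ τ ≤ k * P + P := by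
    refine ⟨⌊τ / P⌋₊, ?_, ?_⟩
    · exact (le_div_iff₀ hP).1 (Nat.floor_le (by positivity))
    · have := (div_lt_iff₀ hP).1 (Nat.lt_floor_add_one (τ / P))
      linarith
  rw [← intervalIntegral.integral_add_adjacent_intervals
    (hc.intervalIntegrable 0 (k * P)) (hc.intervalIntegrable _ _)]
  have hrest : ‖∫ s in (k * P)..τ, g (Y s) s‖ ≤ B * P := by
    refine (intervalIntegral.norm_integral_le_of_norm_le_const
      fun s _ => hbdd _ (hYD s) s).trans ?_
    rw [abs_of_nonneg (by linarith)]
    gcongr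
    linarith
  refine (norm_add_le _ _).trans (add_le_add ((hperiods k).trans ?_) hrest)
  gcongr

/-- Gronwall estimate for `z - y` when `z' = ε F(z, τ)` and `y' = ε (F(y, τ) - h(τ))`, in terms
of a bound on the primitive of the perturbation `h`. -/
lemma norm_sub_le_of_norm_integral_le [CompleteSpace E] {D : Set E} {F : E → ℝ → E}
    {L C ε a : ℝ} (hL : 0 < L) (hε : 0 < ε)
    (hlip : ∀ τ, ∀ x₁ ∈ D, ∀ x₂ ∈ D, ‖F x₁ τ - F x₂ τ‖ ≤ L * ‖x₁ - x₂‖)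
    {h : ℝ → E} (hh : Continuous h) (hC : ∀ τ ∈ Icc 0 a, ‖∫ s in (0:ℝ)..τ, h s‖ ≤ C)
    {z y : ℝ → E} (h0 : z 0 = y 0)
    (hz : ∀ τ ∈ Icc 0 a, HasDerivAt z (ε • F (z τ) τ) τ)
    (hy : ∀ τ ∈ Icc 0 a, HasDerivAt y (ε • (F (y τ) τ - h τ)) τ)
    (hzD : ∀ τ ∈ Icc 0 a, z τ ∈ D) (hyD : ∀ τ ∈ Icc 0 a, y τ ∈ D)
    {τ : ℝ} (hτ : τ ∈ Icc 0 a) : ‖z τ - y τ‖ ≤ ε * C * Real.exp (ε * L * τ) := by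
  set G : ℝ → E := fun t => ∫ s in (0:ℝ)..t, h s
  have hG : ∀ t, HasDerivAt G (h t) t := fun t => hh.integral_hasStrictDerivAt 0 t |>.hasDerivAt
  set v : ℝ → E := fun t => z t - y t - ε • G t
  have hv : ∀ t ∈ Icc 0 a, HasDerivAt v (ε • (F (z t) t - F (y t) t)) t := by
    intro t ht
    refine (((hz t ht).sub (hy t ht)).sub ((hG t).const_smul ε)).congr_deriv ?_
    module
  have huv : ∀ t ∈ Icc 0 a, ‖z t - y t‖ ≤ ‖v t‖ + ε * C := by
    intro t ht
    have huv' : z t - y t = v t + ε • G t := by simp [v]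
    rw [huv']
    refine (norm_add_le _ _).trans ?_
    rw [norm_smul, Real.norm_of_nonneg hε.le]
    gcongr
    exact hC t ht
  have hgron := norm_le_gronwallBound_of_norm_deriv_right_le (f := v)
    (f' := fun t => ε • (F (z t) t - F (y t) t)) (δ := 0) (K := ε * L) (ε := ε * L * (ε * C))
    (fun t ht => (hv t ht).continuousAt.continuousWithinAt)
    (fun t ht => (hv t (Ico_subset_Icc_self ht)).hasDerivWithinAt)
    (by simp [v, G, h0])
    (fun t ht => by
      have ht' := Ico_subset_Icc_self ht
      rw [norm_smul, Real.norm_of_nonneg hε.le]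
      calc ε * ‖F (z t) t - F (y t) t‖ ≤ ε * (L * (‖v t‖ + ε * C)) := by
            gcongr
            refine (hlip t _ (hzD t ht') _ (hyD t ht')).trans ?_
            gcongr
            exact huv t ht'
        _ = ε * L * ‖v t‖ + ε * L * (ε * C) := by ring) τ hτ
  rw [gronwallBound_of_K_ne_0 (by positivity), sub_zero, mul_div_cancel_left₀ _ (by positivity)]
    at hgron
  linarith [huv τ hτ]

lemma norm_sub_clamp_le {a K : ℝ} (ha : 0 ≤ a) (hK : 0 ≤ K) {y y' : ℝ → E}
    (hy : ∀ t ∈ Icc 0 a, HasDerivAt y (y' t) t) (hy' : ∀ t ∈ Icc 0 a, ‖y' t‖ ≤ K) (s t : ℝ) :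
    ‖y (projIcc 0 a ha s) - y (projIcc 0 a ha t)‖ ≤ K * |s - t| := by
  refine ((convex_Icc 0 a).norm_image_sub_le_of_norm_hasDerivWithin_le
    (fun t ht => (hy t ht).hasDerivWithinAt) hy' (projIcc 0 a ha t).2
    (projIcc 0 a ha s).2).trans ?_
  gcongr
  exact abs_projIcc_sub_projIcc ha

end Averaging

/-- Averaging theorem (Theorem 1): solutions of the original fast-time system
`z' = ε F(z, τ)` and of the averaged system `y' = ε F̄(y)` that start at the same
point of a bounded open set `D` and remain in `D` on `[0, T/ε]` stay `O(ε)`-close. -/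
theorem averaging_theorem {n : ℕ}
    (D : Set (EuclideanSpace ℝ (Fin n))) (hD_open : IsOpen D)
    (hD_bdd : Bornology.IsBounded D)
    (F : EuclideanSpace ℝ (Fin n) → ℝ → EuclideanSpace ℝ (Fin n))
    (hF_cont : Continuous fun p : EuclideanSpace ℝ (Fin n) × ℝ => F p.1 p.2)
    (hF_per : ∀ (z : EuclideanSpace ℝ (Fin n)) (τ : ℝ), F z (τ + 2 * Real.pi) = F z τ)
    (M : ℝ) (hF_bdd : ∀ z ∈ D, ∀ τ : ℝ, ‖F z τ‖ ≤ M)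
    (ℓ : ℝ)
    (hF_lip : ∀ τ : ℝ, ∀ z₁ ∈ D, ∀ z₂ ∈ D, ‖F z₁ τ - F z₂ τ‖ ≤ ℓ * ‖z₁ - z₂‖)
    (Fbar : EuclideanSpace ℝ (Fin n) → EuclideanSpace ℝ (Fin n))
    (hFbar : ∀ y, Fbar y = (1 / (2 * Real.pi)) • ∫ τ in (0:ℝ)..(2 * Real.pi), F y τ)
    (T : ℝ) (hT : 0 < T) (εmax : ℝ) (hεmax : 0 < εmax)
    (z₀ : EuclideanSpace ℝ (Fin n)) (hz₀ : z₀ ∈ D) :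
    ∃ c : ℝ, 0 < c ∧ ∀ ε : ℝ, 0 < ε → ε ≤ εmax →
      ∀ z y : ℝ → EuclideanSpace ℝ (Fin n),
        z 0 = z₀ → y 0 = z₀ →
        (∀ τ ∈ Set.Icc (0:ℝ) (T / ε), HasDerivAt z (ε • F (z τ) τ) τ) →
        (∀ τ ∈ Set.Icc (0:ℝ) (T / ε), HasDerivAt y (ε • Fbar (y τ)) τ) →
        (∀ τ ∈ Set.Icc (0:ℝ) (T / ε), z τ ∈ D) →
        (∀ τ ∈ Set.Icc (0:ℝ) (T / ε), y τ ∈ D) →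
        ∀ τ ∈ Set.Icc (0:ℝ) (T / ε), ‖z τ - y τ‖ ≤ c * ε := by
  have hπ : (0:ℝ) < 2 * Real.pi := by positivity
  have hM : 0 ≤ M := (norm_nonneg _).trans (hF_bdd z₀ hz₀ 0)
  set L : ℝ := |ℓ| + 1
  have hL : 0 < L := by positivity
  have hlip : ∀ τ : ℝ, ∀ z₁ ∈ D, ∀ z₂ ∈ D, ‖F z₁ τ - F z₂ τ‖ ≤ L * ‖z₁ - z₂‖ := by
    intro τ z₁ h₁ z₂ h₂
    refine (hF_lip τ z₁ h₁ z₂ h₂).trans ?_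
    gcongr
    exact (le_abs_self ℓ).trans (by simp [L])
  have hFx : ∀ x, Continuous (F x) := fun x =>
    hF_cont.comp (continuous_const.prodMk continuous_id)
  have hmean_le : ∀ (f : ℝ → EuclideanSpace ℝ (Fin n)) (B : ℝ), (∀ τ, ‖f τ‖ ≤ B) →
      ‖(1 / (2 * Real.pi)) • ∫ τ in (0:ℝ)..(2 * Real.pi), f τ‖ ≤ B := by
    intro f B hf
    have h := intervalIntegral.norm_integral_le_of_norm_le_const (a := 0) (b := 2 * Real.pi)
      (f := f) (fun τ _ => hf τ)
    rw [sub_zero, abs_of_pos hπ] at h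
    rw [norm_smul, Real.norm_of_nonneg (by positivity), one_div, inv_mul_le_iff₀ hπ]
    linarith
  have hFbar_bdd : ∀ x ∈ D, ‖Fbar x‖ ≤ M := fun x hx => by
    rw [hFbar]
    exact hmean_le _ _ (hF_bdd x hx)
  have hFbar_lip : ∀ x₁ ∈ D, ∀ x₂ ∈ D, ‖Fbar x₁ - Fbar x₂‖ ≤ L * ‖x₁ - x₂‖ := by
    intro x₁ h₁ x₂ h₂
    rw [hFbar, hFbar, ← smul_sub, ← intervalIntegral.integral_sub
      ((hFx x₁).intervalIntegrable _ _) ((hFx x₂).intervalIntegrable _ _)]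
    exact hmean_le _ _ fun τ => hlip τ x₁ h₁ x₂ h₂
  have hFbar_cont : Continuous Fbar := by
    rw [funext hFbar]
    exact (intervalIntegral.continuous_parametric_intervalIntegral_of_continuous'
      (μ := MeasureTheory.volume) hF_cont 0 (2 * Real.pi)).const_smul (1 / (2 * Real.pi))
  set g : EuclideanSpace ℝ (Fin n) → ℝ → EuclideanSpace ℝ (Fin n) := fun x s => F x s - Fbar x
  have hg : Continuous fun p : EuclideanSpace ℝ (Fin n) × ℝ => g p.1 p.2 :=
    hF_cont.sub (hFbar_cont.comp continuous_fst)
  have hg_per : ∀ x, Function.Periodic (g x) (2 * Real.pi) := fun x s => by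
    simp only [g, hF_per]
  have hg_mean : ∀ x, ∫ s in (0:ℝ)..(2 * Real.pi), g x s = 0 := fun x => by
    simp only [g]
    rw [intervalIntegral.integral_sub ((hFx x).intervalIntegrable _ _) intervalIntegrable_const,
      intervalIntegral.integral_const, hFbar, sub_zero, smul_smul, mul_one_div_cancel hπ.ne',
      one_smul, sub_self]
  have hg_bdd : ∀ x ∈ D, ∀ s, ‖g x s‖ ≤ 2 * M := fun x hx s =>
    (norm_sub_le _ _).trans (by linarith [hF_bdd x hx s, hFbar_bdd x hx])
  have hg_lip : ∀ s, ∀ x₁ ∈ D, ∀ x₂ ∈ D, ‖g x₁ s - g x₂ s‖ ≤ 2 * L * ‖x₁ - x₂‖ := by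
    intro s x₁ h₁ x₂ h₂
    have hsplit : g x₁ s - g x₂ s = (F x₁ s - F x₂ s) - (Fbar x₁ - Fbar x₂) := by
      simp only [g]
      abel
    rw [hsplit]
    refine (norm_sub_le _ _).trans ?_
    linarith [hlip s x₁ h₁ x₂ h₂, hFbar_lip x₁ h₁ x₂ h₂]
  set C : ℝ := 2 * L * M * (2 * Real.pi) * T + 2 * M * (2 * Real.pi)
  have hC : 0 ≤ C := by positivity
  refine ⟨C * Real.exp (L * T) + 1, by positivity, ?_⟩
  intro ε hε _ z y hz0 hy0 hz hy hzD hyD τ hτ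
  have ha : 0 ≤ T / ε := by positivity
  have hετ : ∀ t ∈ Set.Icc (0:ℝ) (T / ε), ε * t ≤ T := fun t ht => by
    rw [mul_comm]
    exact (le_div_iff₀ hε).1 ht.2
  set Y : ℝ → EuclideanSpace ℝ (Fin n) := fun s => y (Set.projIcc 0 (T / ε) ha s)
  have hYy : ∀ t ∈ Set.Icc (0:ℝ) (T / ε), Y t = y t := fun t ht => by
    simp only [Y, Set.projIcc_of_mem ha ht]
  have hYD : ∀ s, Y s ∈ D := fun s => hyD _ (Set.projIcc 0 (T / ε) ha s).2
  have hY : Continuous Y := by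
    have hyc : ContinuousOn y (Set.Icc 0 (T / ε)) := fun t ht =>
      (hy t ht).continuousAt.continuousWithinAt
    exact hyc.domRestrict.comp continuous_projIcc
  have hYlip : ∀ s t, ‖Y s - Y t‖ ≤ ε * M * |s - t| :=
    norm_sub_clamp_le ha (by positivity) hy fun t ht => by
      rw [norm_smul, Real.norm_of_nonneg hε.le]
      gcongr
      exact hFbar_bdd _ (hyD t ht)
  have hint : ∀ t ∈ Set.Icc (0:ℝ) (T / ε), ‖∫ s in (0:ℝ)..t, g (Y s) s‖ ≤ C := by
    intro t ht
    refine (norm_integral_le_of_zero_mean hπ (by positivity) (by positivity) hg hg_per hg_mean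
      hg_bdd hg_lip hY hYD hYlip ht.1).trans ?_
    calc 2 * L * (ε * M) * (2 * Real.pi) * t + 2 * M * (2 * Real.pi)
        = 2 * L * M * (2 * Real.pi) * (ε * t) + 2 * M * (2 * Real.pi) := by ring
      _ ≤ C := by
        simp only [C]
        gcongr
        exact hετ t ht
  have hy' : ∀ t ∈ Set.Icc (0:ℝ) (T / ε),
      HasDerivAt y (ε • (F (y t) t - g (Y t) t)) t := fun t ht => by
    simpa only [g, hYy t ht, sub_sub_cancel] using hy t ht
  have hmain := norm_sub_le_of_norm_integral_le hL hε hlip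
    (hg.comp (hY.prodMk continuous_id)) hint (hz0.trans hy0.symm) hz hy' hzD hyD hτ
  calc ‖z τ - y τ‖ ≤ ε * C * Real.exp (ε * L * τ) := hmain
    _ ≤ ε * C * Real.exp (L * T) := by
      have hexp : ε * L * τ ≤ L * T := by
        linarith [mul_le_mul_of_nonneg_left (hετ τ hτ) hL.le]
      gcongr ?_ * Real.exp ?_
    _ ≤ (C * Real.exp (L * T) + 1) * ε := by linarith
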